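/- arXiv:1610.06048 — 3 statements merged into one kernel-verified Lean document; each statement's English description precedes it below -/
import Mathlib

section
/- For an integer m ≥ 1 and a real number p, define g_m(p) = Σ_{i=1}^{m} (1/i)·C(2i−2, i−1)·pⁱ + (1/2)·C(2m, m)·pᵐ (this is the asymptotic conditional k-NN error rate R^k(X) with odd k = 2m − 1 and p = q₁(X)q₂(X)). Then for every real p with 0 ≤ p ≤ 1/4 and every m ≥ 1, g_{m+1}(p) ≤ g_m(p); that is, the asymptotic conditional error rates of the k-NN classifier for odd k form a decreasing chain ⋯ ≤ R⁵(X) ≤ R³(X) ≤ R(X). -/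
/-- The asymptotic conditional error rate of the `k`-NN classifier for odd `k = 2m − 1`,
as a function of `p = q₁ q₂`:
`g_m(p) = Σ_{i=1}^m (1/i)·C(2i−2, i−1)·pⁱ + (1/2)·C(2m, m)·pᵐ`. -/
noncomputable def knnErrorRate (m : ℕ) (p : ℝ) : ℝ :=
  (∑ i ∈ Finset.Icc 1 m, (1 / (i : ℝ)) * (Nat.choose (2 * i - 2) (i - 1) : ℝ) * p ^ i)
    + (1 / 2) * (Nat.choose (2 * m) m : ℝ) * p ^ m

/-- Consecutive error rates differ by `C(2m, m)·pᵐ·(2p − 1/2)`. -/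
theorem knnErrorRate_succ (m : ℕ) (p : ℝ) :
    knnErrorRate (m + 1) p =
      knnErrorRate m p + (Nat.centralBinom m : ℝ) * p ^ m * (2 * p - 1 / 2) := by
  have hrec : ((m : ℝ) + 1) * (Nat.centralBinom (m + 1) : ℝ) =
      2 * (2 * m + 1) * (Nat.centralBinom m : ℝ) := by
    exact_mod_cast Nat.succ_mul_centralBinom_succ m
  have hm : (m : ℝ) + 1 ≠ 0 := by positivity
  have hidx : 2 * (m + 1) - 2 = 2 * m := by omega
  unfold knnErrorRate
  rw [Finset.sum_Icc_succ_top (by omega), hidx, Nat.add_sub_cancel,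
    ← Nat.centralBinom_eq_two_mul_choose, ← Nat.centralBinom_eq_two_mul_choose,
    eq_div_of_mul_eq hm ((mul_comm _ _).trans hrec)]
  push_cast
  field_simp
  ring

/-- For every `p ∈ [0, 1/4]` and every `m ≥ 1`, `g_{m+1}(p) ≤ g_m(p)`;
i.e. the asymptotic conditional `k`-NN error rates for odd `k` form a decreasing chain
`⋯ ≤ R⁵(X) ≤ R³(X) ≤ R(X)`. -/
theorem knnErrorRate_antitone
    (p : ℝ) (hp0 : 0 ≤ p) (hp : p ≤ 1 / 4) (m : ℕ) (hm : 1 ≤ m) :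
    knnErrorRate (m + 1) p ≤ knnErrorRate m p := by
  have hc : 0 ≤ (Nat.centralBinom m : ℝ) * p ^ m := by positivity
  rw [knnErrorRate_succ]
  linarith [mul_nonpos_of_nonneg_of_nonpos hc (by linarith : 2 * p - 1 / 2 ≤ 0)]
end

section
/- For an integer m ≥ 1 and a real number p with 0 ≤ p ≤ 1/4, let g_m(p) = Σ_{i=1}^{m} (1/i)·C(2i−2, i−1)·pⁱ + (1/2)·C(2m, m)·pᵐ. Then (1 − √(1 − 4p))/2 ≤ g_m(p) ≤ 2p ≤ 1 − √(1 − 4p); that is, writing R*(X) = (1 − √(1 − 4p))/2 for the conditional Bayes error and R(X) = g_1(p) = 2p for the asymptotic conditional 1-NN error, every asymptotic conditional k-NN error rate with odd k satisfies R*(X) ≤ R^k(X) ≤ R(X) ≤ 2 R*(X). -/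
open Finset in
/-- The partial sums `Σ_{j<n} C(2j, j) pʲ` of the generating function of the central binomial
coefficients. -/
noncomputable def centralBinomSum (n : ℕ) (p : ℝ) : ℝ :=
  ∑ j ∈ range n, (Nat.centralBinom j : ℝ) * p ^ j

open Finset in
theorem knnErrorRate_eq_half_sub (m : ℕ) (p : ℝ) :
    knnErrorRate m p = 1 / 2 - (1 - 4 * p) / 2 * centralBinomSum m p := by
  induction m with
  | zero => simp [knnErrorRate, centralBinomSum]
  | succ n ih =>
    have hB : ((n : ℝ) + 1) * (Nat.centralBinom (n + 1) : ℝ) =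
        2 * (2 * n + 1) * Nat.centralBinom n := by
      exact_mod_cast Nat.succ_mul_centralBinom_succ n
    have hn : (n : ℝ) + 1 ≠ 0 := by positivity
    have hB' : (Nat.centralBinom (n + 1) : ℝ) =
        2 * (2 * n + 1) * Nat.centralBinom n / (n + 1) := by
      rw [eq_div_iff hn, ← hB]; ring
    have hsub : 2 * (n + 1) - 2 = 2 * n := by omega
    simp only [knnErrorRate, centralBinomSum, ← Nat.centralBinom_eq_two_mul_choose] at ih ⊢
    rw [sum_Icc_succ_top (by omega), sum_range_succ, hsub, Nat.add_sub_cancel,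
      ← Nat.centralBinom_eq_two_mul_choose, eq_sub_of_add_eq ih, hB']
    push_cast
    field_simp
    ring

open Finset in
theorem hasDerivAt_centralBinomSum (n : ℕ) (p : ℝ) :
    HasDerivAt (centralBinomSum n)
      (∑ j ∈ range n, (Nat.centralBinom j : ℝ) * (j * p ^ (j - 1))) p :=
  HasDerivAt.fun_sum fun j _ => (hasDerivAt_pow j p).const_mul _

open Finset in
theorem two_mul_centralBinomSum_sub_deriv (n : ℕ) (p : ℝ) :
    2 * centralBinomSum n p
      - (1 - 4 * p) * ∑ j ∈ range n, (Nat.centralBinom j : ℝ) * (j * p ^ (j - 1)) =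
    n * Nat.centralBinom n * p ^ (n - 1) := by
  induction n with
  | zero => simp [centralBinomSum]
  | succ n ih =>
    have hB : ((n : ℝ) + 1) * (Nat.centralBinom (n + 1) : ℝ) =
        2 * (2 * n + 1) * Nat.centralBinom n := by
      exact_mod_cast Nat.succ_mul_centralBinom_succ n
    have hpow : (n : ℝ) * p ^ n = n * p ^ (n - 1) * p := by
      cases n with
      | zero => simp
      | succ k => rw [Nat.add_sub_cancel, pow_succ]; ring
    simp only [centralBinomSum] at ih ⊢
    rw [sum_range_succ, sum_range_succ, Nat.add_sub_cancel]
    push_cast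
    rw [hB]
    linear_combination ih - 4 * (Nat.centralBinom n : ℝ) * hpow

theorem centralBinomSum_nonneg (n : ℕ) {p : ℝ} (hp : 0 ≤ p) : 0 ≤ centralBinomSum n p :=
  Finset.sum_nonneg fun _ _ => by positivity

theorem one_le_centralBinomSum {n : ℕ} (hn : 1 ≤ n) {p : ℝ} (hp : 0 ≤ p) :
    1 ≤ centralBinomSum n p := by
  have h := Finset.single_le_sum (f := fun j => (Nat.centralBinom j : ℝ) * p ^ j)
    (fun _ _ => by positivity) (Finset.mem_range.2 hn)
  simpa [centralBinomSum] using h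

theorem one_sub_four_mul_centralBinomSum_sq_le_one (n : ℕ) {p : ℝ} (hp : 0 ≤ p) :
    (1 - 4 * p) * centralBinomSum n p ^ 2 ≤ 1 := by
  have hderiv (x : ℝ) : HasDerivAt (fun x => (1 - 4 * x) * centralBinomSum n x ^ 2)
      (-2 * centralBinomSum n x * (n * Nat.centralBinom n * x ^ (n - 1))) x := by
    rw [← two_mul_centralBinomSum_sub_deriv]
    refine ((((hasDerivAt_id x).const_mul 4).const_sub 1).mul
      ((hasDerivAt_centralBinomSum n x).pow 2)).congr_deriv ?_
    simp
    ring
  have hanti : AntitoneOn (fun x => (1 - 4 * x) * centralBinomSum n x ^ 2) (Set.Ici 0) := by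
    refine antitoneOn_of_deriv_nonpos (convex_Ici 0)
      (fun x _ => (hderiv x).continuousAt.continuousWithinAt)
      (fun x _ => (hderiv x).differentiableAt.differentiableWithinAt) fun x hx => ?_
    have hx : 0 ≤ x := interior_subset hx
    rw [(hderiv x).deriv, neg_mul, neg_mul, neg_nonpos]
    have := centralBinomSum_nonneg n hx
    positivity
  refine (hanti Set.self_mem_Ici hp hp).trans ?_
  cases n <;> simp [centralBinomSum, Finset.sum_range_succ']

/-- For `p ∈ [0, 1/4]` and `m ≥ 1`,
`(1 − √(1 − 4p))/2 ≤ g_m(p) ≤ 2p ≤ 1 − √(1 − 4p)`; i.e. the asymptotic conditional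
`k`-NN error rates with odd `k` satisfy `R*(X) ≤ R^k(X) ≤ R(X) ≤ 2 R*(X)`. -/
theorem knnErrorRate_bounds
    (p : ℝ) (hp0 : 0 ≤ p) (hp : p ≤ 1 / 4) (m : ℕ) (hm : 1 ≤ m) :
    (1 - Real.sqrt (1 - 4 * p)) / 2 ≤ knnErrorRate m p ∧
    knnErrorRate m p ≤ 2 * p ∧
    2 * p ≤ 1 - Real.sqrt (1 - 4 * p) := by
  have hs := Real.sqrt_nonneg (1 - 4 * p)
  have hsq := Real.sq_sqrt (show 0 ≤ 1 - 4 * p by linarith)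
  rw [knnErrorRate_eq_half_sub]
  refine ⟨?_, ?_, by nlinarith⟩
  · have hle : Real.sqrt (1 - 4 * p) * centralBinomSum m p ≤ 1 := by
      refine (sq_le_sq₀ (mul_nonneg hs (centralBinomSum_nonneg m hp0)) zero_le_one).1 ?_
      rw [mul_pow, hsq, one_pow]
      exact one_sub_four_mul_centralBinomSum_sq_le_one m hp0
    linear_combination (Real.sqrt (1 - 4 * p) / 2) * hle - centralBinomSum m p / 2 * hsq
  · have hnonneg : 0 ≤ 1 - 4 * p := by linarith
    linear_combination (1 / 2) * mul_le_mul_of_nonneg_left (one_le_centralBinomSum hm hp0) hnonneg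
end

section
/- For an integer m ≥ 1 and a real number p with 0 ≤ p ≤ 1/4, let g_m(p) = Σ_{i=1}^{m} (1/i)·C(2i−2, i−1)·pⁱ + (1/2)·C(2m, m)·pᵐ. Then lim_{m→∞} g_m(p) = (1 − √(1 − 4p))/2; that is, as the number of neighbors k = 2m − 1 tends to infinity, the asymptotic conditional k-NN error rate converges to the conditional Bayes error. -/
open Filter

theorem sum_catalan_mul_quarter_pow (n : ℕ) :
    ∑ i ∈ Finset.range n, (catalan i : ℝ) * (1 / 4) ^ i
      = 2 - 2 * ((n.centralBinom : ℝ) * (1 / 4) ^ n) := by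
  induction n with
  | zero => simp
  | succ n ih =>
    have hc : ((n : ℝ) + 1) * catalan n = n.centralBinom := by
      exact_mod_cast succ_mul_catalan_eq_centralBinom n
    have hb : ((n : ℝ) + 1) * (n + 1).centralBinom = 2 * (2 * n + 1) * n.centralBinom := by
      exact_mod_cast Nat.succ_mul_centralBinom_succ n
    have hb' : ((n + 1).centralBinom : ℝ) = 2 * (2 * n + 1) * catalan n := by
      rw [← hc] at hb
      exact mul_left_cancel₀ (n.cast_add_one_ne_zero) (by linarith)
    rw [Finset.sum_range_succ, ih, hb', ← hc]
    ring

theorem catalan_mul_pow_le {p : ℝ} (hp0 : 0 ≤ p) (hp : p ≤ 1 / 4) (n : ℕ) :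
    (catalan n : ℝ) * p ^ n ≤ catalan n * (1 / 4) ^ n := by
  gcongr

theorem sum_catalan_mul_pow_le_two {p : ℝ} (hp0 : 0 ≤ p) (hp : p ≤ 1 / 4) (n : ℕ) :
    ∑ i ∈ Finset.range n, (catalan i : ℝ) * p ^ i ≤ 2 := by
  refine (Finset.sum_le_sum fun i _ => catalan_mul_pow_le hp0 hp i).trans ?_
  rw [sum_catalan_mul_quarter_pow]
  have : 0 ≤ (n.centralBinom : ℝ) * (1 / 4) ^ n := by positivity
  linarith

theorem summable_catalan_mul_pow {p : ℝ} (hp0 : 0 ≤ p) (hp : p ≤ 1 / 4) :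
    Summable fun n => (catalan n : ℝ) * p ^ n :=
  summable_of_sum_range_le (fun _ => by positivity) (sum_catalan_mul_pow_le_two hp0 hp)

theorem tsum_catalan_mul_pow_eq {p : ℝ} (hp0 : 0 ≤ p) (hp : p ≤ 1 / 4) :
    ∑' n, (catalan n : ℝ) * p ^ n = 1 + p * (∑' n, (catalan n : ℝ) * p ^ n) ^ 2 := by
  have hs := summable_catalan_mul_pow hp0 hp
  rw [sq, tsum_mul_tsum_eq_tsum_sum_antidiagonal_of_summable_norm hs.norm hs.norm,
    hs.tsum_eq_zero_add, ← tsum_mul_left]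
  congr 1
  · simp
  · refine tsum_congr fun n => ?_
    rw [catalan_succ']
    push_cast
    rw [Finset.sum_mul, Finset.mul_sum]
    refine Finset.sum_congr rfl fun ij hij => ?_
    rw [← Finset.HasAntidiagonal.mem_antidiagonal.1 hij]
    ring

theorem mul_tsum_catalan_mul_pow {p : ℝ} (hp0 : 0 ≤ p) (hp : p ≤ 1 / 4) :
    p * ∑' n, (catalan n : ℝ) * p ^ n = (1 - √(1 - 4 * p)) / 2 := by
  have hle : ∑' n, (catalan n : ℝ) * p ^ n ≤ 2 :=
    Real.tsum_le_of_sum_range_le (fun _ => by positivity) (sum_catalan_mul_pow_le_two hp0 hp)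
  have heq := tsum_catalan_mul_pow_eq hp0 hp
  set C := ∑' n, (catalan n : ℝ) * p ^ n
  have hsqrt : √(1 - 4 * p) = 1 - 2 * (p * C) := by
    rw [Real.sqrt_eq_iff_mul_self_eq (by linarith) (by nlinarith)]
    linear_combination 4 * p * heq
  rw [hsqrt]
  ring

theorem tendsto_centralBinom_mul_quarter_pow :
    Tendsto (fun n : ℕ => (n.centralBinom : ℝ) * (1 / 4) ^ n) atTop (nhds 0) := by
  have hsum : ∑' n, (catalan n : ℝ) * (1 / 4) ^ n = 2 := by
    have h := mul_tsum_catalan_mul_pow (p := 1 / 4) (by norm_num) le_rfl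
    norm_num at h ⊢
    linarith
  have h := (summable_catalan_mul_pow (p := 1 / 4) (by norm_num) le_rfl).hasSum.tendsto_sum_nat
  rw [hsum] at h
  simp_rw [sum_catalan_mul_quarter_pow] at h
  convert (h.const_sub 2).div_const 2 using 2 <;> ring

theorem tendsto_centralBinom_mul_pow {p : ℝ} (hp0 : 0 ≤ p) (hp : p ≤ 1 / 4) :
    Tendsto (fun n : ℕ => (n.centralBinom : ℝ) * p ^ n) atTop (nhds 0) :=
  squeeze_zero (fun _ => by positivity) (fun _ => by gcongr) tendsto_centralBinom_mul_quarter_pow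

theorem knnErrorRate_eq (m : ℕ) (p : ℝ) :
    knnErrorRate m p = p * ∑ i ∈ Finset.range m, (catalan i : ℝ) * p ^ i
      + 1 / 2 * (m.centralBinom * p ^ m) := by
  rw [knnErrorRate, ← Nat.centralBinom_eq_two_mul_choose, ← Finset.Ico_add_one_right_eq_Icc,
    Finset.sum_Ico_eq_sum_range, Finset.mul_sum, mul_assoc]
  congr 1
  refine Finset.sum_congr rfl fun i _ => ?_
  have hc : ((i : ℝ) + 1) * catalan i = i.centralBinom := by
    exact_mod_cast succ_mul_catalan_eq_centralBinom i
  have hi : (i : ℝ) + 1 ≠ 0 := i.cast_add_one_ne_zero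
  rw [add_comm 1 i, show 2 * (i + 1) - 2 = 2 * i by omega, Nat.add_sub_cancel,
    ← Nat.centralBinom_eq_two_mul_choose, ← hc]
  push_cast
  field_simp
  ring

/-- For `p ∈ [0, 1/4]`, `lim_{m→∞} g_m(p) = (1 − √(1 − 4p))/2`; i.e. as the
number of neighbors `k = 2m − 1` tends to infinity, the asymptotic conditional `k`-NN
error rate converges to the conditional Bayes error. -/
theorem knnErrorRate_tendsto_bayes
    (p : ℝ) (hp0 : 0 ≤ p) (hp : p ≤ 1 / 4) :
    Tendsto (fun m : ℕ => knnErrorRate m p) atTop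
      (nhds ((1 - Real.sqrt (1 - 4 * p)) / 2)) := by
  simp_rw [knnErrorRate_eq, ← mul_tsum_catalan_mul_pow hp0 hp]
  simpa only [mul_zero, add_zero] using ((summable_catalan_mul_pow hp0 hp).hasSum.tendsto_sum_nat.const_mul p).add
    ((tendsto_centralBinom_mul_pow hp0 hp).const_mul (1 / 2))
end
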